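/- arXiv:1808.07137 — 2 statements merged into one kernel-verified Lean document; each statement's English description precedes it below -/
import Mathlib

section
/- Let n ≥ 1, m ≥ 1, M ≥ 1. Let F ∈ C_c^∞(ℝ^{n+1}) and set φ_γ(x) = ∂^γ F(x,0) for γ ∈ ℕ^{n+1} with |γ| = m−1, writing γ = (ξ,ℓ) with ξ ∈ ℕⁿ and ℓ ∈ ℕ. Define the array 𝒪φ, indexed by δ = (ξ,ℓ) ∈ ℕⁿ × ℕ with |ξ| + ℓ = m+2M−1, by the recursion: (𝒪φ)_{(ξ,ℓ)} = 0 if ℓ < 2M, and (𝒪φ)_{(ξ,ℓ)} = φ_{(ξ,ℓ−2M)} − Σ_{k=1}^{M} Σ_{ζ ∈ ℕⁿ, |ζ| = k} (M!/(ζ!(M−k)!)) (𝒪φ)_{(ξ+2ζ, ℓ−2k)} if 2M ≤ ℓ ≤ 2M+m−1. Then there exists H ∈ C_c^∞(ℝ^{n+1}) such that ∂^δ H(x,0) = (𝒪φ)_δ(x) for all x ∈ ℝⁿ and all δ ∈ ℕ^{n+1} with |δ| = m+2M−1. -/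
/- STATEMENT 12: The array `𝒪φ` built by the recursion of Section `sec:D:high` is the
trace of order `m+2M−1` of a compactly supported smooth function. -/

open MeasureTheory Set Finset
noncomputable section

/-- The horizontal partial derivative `∂_{x_i}` on `ℝ^{n+1} = ℝⁿ × ℝ`. -/
def hpd {n : ℕ} (i : Fin n) (f : (Fin n → ℝ) × ℝ → ℂ) : (Fin n → ℝ) × ℝ → ℂ :=
  fun p => fderiv ℝ f p (Pi.single i 1, 0)

/-- The vertical partial derivative `∂_t` on `ℝ^{n+1} = ℝⁿ × ℝ`. -/
def vpd {n : ℕ} (f : (Fin n → ℝ) × ℝ → ℂ) : (Fin n → ℝ) × ℝ → ℂ :=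
  fun p => fderiv ℝ f p (0, 1)

/-- Horizontal higher partial derivative `∂_x^ξ` for `ξ ∈ ℕⁿ`. -/
def hmpd {n : ℕ} (ξ : Fin n → ℕ) (f : (Fin n → ℝ) × ℝ → ℂ) : (Fin n → ℝ) × ℝ → ℂ :=
  (List.finRange n).foldr (fun i g => (hpd i)^[ξ i] g) f

/-- The space `C_c^∞(ℝ^{n+1})` of smooth compactly supported complex functions. -/
def smoothCompact (n : ℕ) : Submodule ℂ ((Fin n → ℝ) × ℝ → ℂ) where
  carrier := {f | ContDiff ℝ (⊤ : ℕ∞) f ∧ HasCompactSupport f}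
  add_mem' hf hg := ⟨hf.1.add hg.1, hf.2.add hg.2⟩
  zero_mem' := ⟨contDiff_const, HasCompactSupport.zero⟩
  smul_mem' c _ hf := ⟨contDiff_const.smul hf.1, HasCompactSupport.smul_left (f := fun _ => c) hf.2⟩

namespace smoothCompact

variable {n : ℕ}

lemma coe_contDiff (f : smoothCompact n) : ContDiff ℝ (⊤ : ℕ∞) f.1 := f.2.1

lemma coe_differentiable (f : smoothCompact n) : Differentiable ℝ f.1 :=
  (coe_contDiff f).differentiable (by simp)

/-- The directional derivative `∂_v` as an endomorphism of `C_c^∞(ℝ^{n+1})`. -/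
def dirDeriv (v : (Fin n → ℝ) × ℝ) : Module.End ℂ (smoothCompact n) where
  toFun f := ⟨fun p => fderiv ℝ f.1 p v,
    ((coe_contDiff f).fderiv_right (m := (⊤ : ℕ∞)) (by simp)).clm_apply contDiff_const,
    f.2.2.fderiv_apply (𝕜 := ℝ) v⟩
  map_add' f g := by
    ext p
    simp [fderiv_add (coe_differentiable f p) (coe_differentiable g p)]
  map_smul' c f := by
    ext p
    simp [fderiv_const_smul (coe_differentiable f p) c]

lemma dirDeriv_apply (v : (Fin n → ℝ) × ℝ) (f : smoothCompact n) (p : (Fin n → ℝ) × ℝ) :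
    (dirDeriv v f).1 p = fderiv ℝ f.1 p v := rfl

lemma dirDeriv_commute (v w : (Fin n → ℝ) × ℝ) : Commute (dirDeriv v) (dirDeriv w) := by
  ext f p
  have hd : Differentiable ℝ (fderiv ℝ f.1) :=
    ((coe_contDiff f).fderiv_right (m := (⊤ : ℕ∞)) (by simp)).differentiable (by simp)
  have key : ∀ a b : (Fin n → ℝ) × ℝ,
      (dirDeriv a (dirDeriv b f)).1 p = fderiv ℝ (fderiv ℝ f.1) p a b := by
    intro a b
    change fderiv ℝ (fun q => fderiv ℝ f.1 q b) p a = _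
    rw [fderiv_clm_apply (hd p) (differentiableAt_const b)]
    simp
  have hs : IsSymmSndFDerivAt ℝ f.1 p :=
    (coe_contDiff f).contDiffAt.isSymmSndFDerivAt (by
      rw [minSmoothness_of_isRCLikeNormedField]
      exact WithTop.coe_le_coe.2 (le_top : (2 : ℕ∞) ≤ ⊤))
  exact (key v w).trans ((hs v w).trans (key w v).symm)

/-- The iterated horizontal derivative `∂_x^ξ` as an endomorphism of `C_c^∞(ℝ^{n+1})`. -/
def horizontal (ξ : Fin n → ℕ) : Module.End ℂ (smoothCompact n) :=
  ((List.finRange n).map fun i => dirDeriv (Pi.single i 1, 0) ^ ξ i).prod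

/-- The vertical derivative `∂_t` as an endomorphism of `C_c^∞(ℝ^{n+1})`. -/
abbrev vertical : Module.End ℂ (smoothCompact n) := dirDeriv (0, 1)

lemma coe_dirDeriv_pow {v : (Fin n → ℝ) × ℝ}
    {d : ((Fin n → ℝ) × ℝ → ℂ) → (Fin n → ℝ) × ℝ → ℂ}
    (hd : ∀ f p, d f p = fderiv ℝ f p v) (k : ℕ) (f : smoothCompact n) :
    ((dirDeriv v ^ k) f).1 = d^[k] f.1 := by
  rw [Module.End.pow_apply]
  refine (Function.Semiconj.iterate_right (f := Subtype.val) (fun g => ?_) k) f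
  ext p
  exact (hd _ p).symm

lemma coe_vertical_pow (k : ℕ) (f : smoothCompact n) : ((vertical ^ k) f).1 = vpd^[k] f.1 :=
  coe_dirDeriv_pow (fun _ _ => rfl) k f

lemma coe_horizontal (ξ : Fin n → ℕ) (f : smoothCompact n) :
    (horizontal ξ f).1 = hmpd ξ f.1 := by
  unfold horizontal hmpd
  induction List.finRange n with
  | nil => rfl
  | cons i l ih =>
    rw [List.map_cons, List.prod_cons, List.foldr_cons, ← ih, Module.End.mul_apply]
    exact coe_dirDeriv_pow (fun _ _ => rfl) (ξ i) _

lemma horizontal_mul (ξ ζ : Fin n → ℕ) :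
    horizontal ξ * horizontal ζ = horizontal (ξ + ζ) := by
  unfold horizontal
  induction List.finRange n with
  | nil => simp
  | cons i l ih =>
    have hc : Commute (dirDeriv ((Pi.single i 1, 0) : (Fin n → ℝ) × ℝ) ^ ζ i)
        (l.map fun j => dirDeriv ((Pi.single j 1, 0) : (Fin n → ℝ) × ℝ) ^ ξ j).prod := by
      refine Commute.list_prod_right _ _ fun g hg => ?_
      obtain ⟨j, -, rfl⟩ := List.mem_map.1 hg
      exact (dirDeriv_commute _ _).pow_pow _ _
    simp only [List.map_cons, List.prod_cons, Pi.add_apply, pow_add] at ih ⊢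
    rw [← ih, mul_assoc, mul_assoc, ← mul_assoc _ (_ ^ ζ i), ← hc.eq, mul_assoc]

lemma dirDeriv_horizontal_congr {f g : smoothCompact n} (h : ∀ x, f.1 (x, 0) = g.1 (x, 0))
    (v x : Fin n → ℝ) :
    (dirDeriv (v, 0) f).1 (x, 0) = (dirDeriv (v, 0) g).1 (x, 0) := by
  have key : ∀ u : smoothCompact n,
      (dirDeriv (v, 0) u).1 (x, 0) = fderiv ℝ (fun y => u.1 (y, 0)) x v := by
    intro u
    have h1 : HasFDerivAt (fun y : Fin n → ℝ => (y, (0 : ℝ)))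
        (ContinuousLinearMap.inl ℝ (Fin n → ℝ) ℝ) x := hasFDerivAt_prodMk_left x 0
    have h2 := ((coe_differentiable u (x, 0)).hasFDerivAt).comp x h1
    rw [show (fun y => u.1 (y, 0)) = u.1 ∘ fun y => (y, (0 : ℝ)) from rfl, h2.fderiv]
    simp [dirDeriv_apply]
  rw [key, key, funext h]

/-- Horizontal derivatives on `t = 0` depend only on the restriction to `t = 0`. -/
lemma horizontal_congr {f g : smoothCompact n} (h : ∀ x, f.1 (x, 0) = g.1 (x, 0))
    (ξ : Fin n → ℕ) (x : Fin n → ℝ) : (horizontal ξ f).1 (x, 0) = (horizontal ξ g).1 (x, 0) := by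
  unfold horizontal
  induction List.finRange n generalizing x with
  | nil => exact h x
  | cons i l ih =>
    simp only [List.map_cons, List.prod_cons, Module.End.mul_apply]
    induction ξ i generalizing x with
    | zero => exact ih x
    | succ k ihk =>
      simp only [pow_succ', Module.End.mul_apply]
      exact dirDeriv_horizontal_congr ihk _ x

/-- Multiplication by `t` as an endomorphism of `C_c^∞(ℝ^{n+1})`. -/
def mulVertical : Module.End ℂ (smoothCompact n) where
  toFun f := ⟨fun p => (p.2 : ℂ) * f.1 p,
    (Complex.ofRealCLM.contDiff.comp contDiff_snd).mul (coe_contDiff f), f.2.2.mul_left⟩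
  map_add' f g := by
    ext p
    exact mul_add _ _ _
  map_smul' c f := by
    ext p
    exact mul_left_comm _ _ _

lemma mulVertical_apply (f : smoothCompact n) (p : (Fin n → ℝ) × ℝ) :
    (mulVertical f).1 p = (p.2 : ℂ) * f.1 p := rfl

lemma vertical_mul_mulVertical :
    (vertical * mulVertical : Module.End ℂ (smoothCompact n)) = mulVertical * vertical + 1 := by
  ext f p
  have h1 : HasFDerivAt (fun q : (Fin n → ℝ) × ℝ => (q.2 : ℂ))
      (Complex.ofRealCLM.comp (ContinuousLinearMap.snd ℝ (Fin n → ℝ) ℝ)) p :=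
    (Complex.ofRealCLM.comp (ContinuousLinearMap.snd ℝ (Fin n → ℝ) ℝ)).hasFDerivAt
  have h2 := h1.mul (coe_differentiable f p).hasFDerivAt
  change fderiv ℝ ((fun q : (Fin n → ℝ) × ℝ => (q.2 : ℂ)) * f.1) p (0, 1)
    = (p.2 : ℂ) * fderiv ℝ f.1 p (0, 1) + f.1 p
  rw [h2.fderiv]
  simp

lemma vertical_mul_mulVertical_pow (k : ℕ) :
    (vertical * mulVertical ^ (k + 1) : Module.End ℂ (smoothCompact n)) =
      mulVertical ^ k * (mulVertical * vertical + (k + 1 : ℂ) • 1) := by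
  induction k with
  | zero => simp [vertical_mul_mulVertical]
  | succ k ih =>
    rw [pow_succ, ← mul_assoc, ih, mul_assoc, add_mul, mul_assoc, vertical_mul_mulVertical,
      pow_succ, mul_assoc]
    congr 1
    simp only [mul_add, mul_one, smul_mul_assoc, one_mul, mul_smul_comm]
    push_cast
    module

/-- The vertical derivatives of order `j ≤ k` of `t ^ k * f` on `t = 0`. -/
lemma vertical_pow_mulVertical_pow {j k : ℕ} (hjk : j ≤ k) (f : smoothCompact n)
    (x : Fin n → ℝ) :
    ((vertical ^ j) ((mulVertical ^ k) f)).1 (x, 0) =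
      if j = k then (k.factorial : ℂ) * f.1 (x, 0) else 0 := by
  induction j generalizing k f with
  | zero =>
    cases k with
    | zero => simp
    | succ k => simp [pow_succ', Module.End.mul_apply, mulVertical_apply]
  | succ j ih =>
    obtain ⟨k, rfl⟩ : ∃ k', k = k' + 1 := ⟨k - 1, by omega⟩
    rw [pow_succ, Module.End.mul_apply, ← Module.End.mul_apply vertical,
      vertical_mul_mulVertical_pow, Module.End.mul_apply, ih (by omega)]
    simp only [Nat.add_right_cancel_iff]
    split_ifs
    · simp [mulVertical_apply, Nat.factorial_succ]
      ring
    · rfl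

/-- Finitely many vertical derivatives on `t = 0` can be prescribed. -/
lemma exists_vertical_jet (G : ℕ → smoothCompact n) (N : ℕ) :
    ∃ H : smoothCompact n, ∀ ℓ < N, ∀ x, ((vertical ^ ℓ) H).1 (x, 0) = (G ℓ).1 (x, 0) := by
  induction N with
  | zero => exact ⟨0, by simp⟩
  | succ N ih =>
    obtain ⟨H, hH⟩ := ih
    refine ⟨H + (N.factorial : ℂ)⁻¹ • (mulVertical ^ N) (G N - (vertical ^ N) H),
      fun ℓ hℓ x => ?_⟩
    have h := vertical_pow_mulVertical_pow (Nat.lt_succ_iff.1 hℓ) (G N - (vertical ^ N) H) x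
    simp only [map_add, map_smul, Submodule.coe_add, Submodule.coe_smul, Pi.add_apply,
      Pi.smul_apply, h, smul_eq_mul]
    split_ifs with hN
    · subst hN
      simp [Nat.factorial_ne_zero]
    · simp [hH ℓ (by omega)]

end smoothCompact

open smoothCompact

/-- Let `F ∈ C_c^∞(ℝ^{n+1})` and `φ_{(ξ,ℓ)}(x) = ∂_x^ξ∂_t^ℓ F(x,0)`.
Let `𝒪φ` be the array defined by the recursion
`(𝒪φ)_{(ξ,ℓ)} = 0` for `ℓ < 2M`, and
`(𝒪φ)_{(ξ,ℓ)} = φ_{(ξ,ℓ−2M)} − Σ_{k=1}^M Σ_{|ζ|=k} (M!/(ζ!(M−k)!)) (𝒪φ)_{(ξ+2ζ,ℓ−2k)}`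
for `2M ≤ ℓ ≤ 2M+m−1`.  Then there is `H ∈ C_c^∞(ℝ^{n+1})` such that
`∂^δ H(x,0) = (𝒪φ)_δ(x)` for all `δ` with `|δ| = m+2M−1`. -/
theorem statement12 (n m M : ℕ) (hn : 1 ≤ n) (hm : 1 ≤ m) (hM : 1 ≤ M)
    (F : (Fin n → ℝ) × ℝ → ℂ) (hF : ContDiff ℝ (⊤ : ℕ∞) F) (hFc : HasCompactSupport F)
    (O : (Fin n → ℕ) → ℕ → (Fin n → ℝ) → ℂ)
    (hO0 : ∀ (ξ : Fin n → ℕ) (ℓ : ℕ), ℓ < 2 * M → O ξ ℓ = 0)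
    (hOrec : ∀ (ξ : Fin n → ℕ) (ℓ : ℕ), 2 * M ≤ ℓ → ℓ ≤ 2 * M + m - 1 →
      ∀ x : Fin n → ℝ,
        O ξ ℓ x =
          hmpd ξ (vpd^[ℓ - 2 * M] F) (x, 0) -
            ∑ k ∈ Finset.Icc 1 M, ∑ ζ ∈ Finset.Nat.antidiagonalTuple n k,
              ((M.factorial / ((∏ i, (ζ i).factorial) * (M - k).factorial) : ℕ) : ℂ) *
                O (fun i => ξ i + 2 * ζ i) (ℓ - 2 * k) x) :
    ∃ H : (Fin n → ℝ) × ℝ → ℂ, ContDiff ℝ (⊤ : ℕ∞) H ∧ HasCompactSupport H ∧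
      ∀ (ξ : Fin n → ℕ) (ℓ : ℕ), (∑ i, ξ i) + ℓ = m + 2 * M - 1 →
        ∀ x : Fin n → ℝ, hmpd ξ (vpd^[ℓ] H) (x, 0) = O ξ ℓ x := by
  have hG : ∀ ℓ, ∃ G : smoothCompact n, ℓ ≤ 2 * M + m - 1 →
      ∀ ξ x, O ξ ℓ x = (horizontal ξ G).1 (x, 0) := by
    intro ℓ
    induction ℓ using Nat.strong_induction_on with
    | _ ℓ ih =>
      rcases lt_or_ge ℓ (2 * M) with hℓ | hℓ
      · exact ⟨0, fun _ ξ x => by simp [hO0 ξ ℓ hℓ]⟩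
      choose! G hG using ih
      let F' : smoothCompact n := ⟨F, hF, hFc⟩
      refine ⟨(vertical ^ (ℓ - 2 * M)) F' - ∑ k ∈ Finset.Icc 1 M,
        ∑ ζ ∈ Finset.Nat.antidiagonalTuple n k,
          ((M.factorial / ((∏ i, (ζ i).factorial) * (M - k).factorial) : ℕ) : ℂ) •
            horizontal (fun i => 2 * ζ i) (G (ℓ - 2 * k)), fun hle ξ x => ?_⟩
      rw [hOrec ξ ℓ hℓ hle x]
      simp only [map_sub, map_sum, map_smul, Submodule.coe_sub, Submodule.coe_sum,
        Submodule.coe_smul, Pi.sub_apply, Finset.sum_apply, Pi.smul_apply, smul_eq_mul]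
      rw [coe_horizontal, coe_vertical_pow]
      refine congrArg _ (Finset.sum_congr rfl fun k hk => Finset.sum_congr rfl fun ζ _ => ?_)
      have hk1 := (Finset.mem_Icc.1 hk).1
      rw [hG (ℓ - 2 * k) (by omega) (by omega), ← Module.End.mul_apply, horizontal_mul]
      rfl
  choose G hG using hG
  obtain ⟨H, hH⟩ := exists_vertical_jet G (2 * M + m)
  refine ⟨H.1, H.2.1, H.2.2, fun ξ ℓ hξ x => ?_⟩
  rw [hG ℓ (by omega) ξ x, ← horizontal_congr (hH ℓ (by omega)) ξ x, coe_horizontal,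
    coe_vertical_pow]

end
end

section
/- Let n ≥ 1, m ≥ 1, M ≥ 1. Let A = (A_{αβ}) be bounded measurable coefficients of order m on ℝ^{n+1} with ‖A‖_∞ ≤ Λ satisfying the Gårding inequality with constant λ > 0. Let H : ℝ^{n+1} → ℂ have weak derivatives of all orders up to m+2M with ∇^{m+2M} H ∈ L²(ℝ^{n+1}). Suppose u is locally integrable with weak derivatives of order up to m, ∇^m u ∈ L²(ℝ^{n+1}), and Σ_{|α|=|β|=m} ∫_{ℝ^{n+1}} conj(∂^α φ) A_{αβ} ∂^β u = Σ_{|α|=|β|=m} ∫_{ℝ^{n+1}_−} conj(∂^α φ) A_{αβ} ∂^β(Δ^M H) for all φ ∈ C_c^∞(ℝ^{n+1}). Suppose w has weak derivatives of order up to m+2M with ∇^{m+2M} w ∈ L²(ℝ^{n+1}) and Σ_{|α|=|β|=m} ∫_{ℝ^{n+1}} conj(∂^α(Δ^M Φ)) A_{αβ} ∂^β(Δ^M w) = Σ_{|α|=|β|=m} ∫_{ℝ^{n+1}_−} conj(∂^α(Δ^M Φ)) A_{αβ} ∂^β(Δ^M H) for all Φ ∈ C_c^∞(ℝ^{n+1}).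 Then ∂^α u = ∂^α(Δ^M w) almost everywhere on ℝ^{n+1} for every multiindex α with |α| = m. -/
/- STATEMENT 13: The Newton potential identity
`Π^L(1_− A ∇^m Δ^M H) = Δ^M Π^{L̃}(1_− Ã ∇^{m+2M} H)` (Lemma `lem:D:high`),
expressed through the variational characterizations of the two Newton potentials. -/

open MeasureTheory ENNReal Set Finset
noncomputable section

/-- Directional derivative operator on `ℝ^{n+1} = ℝⁿ × ℝ`. -/
def pdir {n : ℕ} (v : (Fin n → ℝ) × ℝ) (f : (Fin n → ℝ) × ℝ → ℂ) :
    (Fin n → ℝ) × ℝ → ℂ :=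
  fun p => fderiv ℝ f p v

/-- The `i`-th coordinate direction in `ℝ^{n+1} = ℝⁿ × ℝ`. -/
def edir (n : ℕ) (i : Fin (n + 1)) : (Fin n → ℝ) × ℝ :=
  if h : (i : ℕ) < n then (Pi.single (⟨i, h⟩ : Fin n) 1, 0) else (0, 1)

/-- Higher partial derivative `∂^γ` on `ℝ^{n+1}` for a multiindex `γ ∈ ℕ^{n+1}`. -/
def mpd {n : ℕ} (γ : Fin (n + 1) → ℕ) (f : (Fin n → ℝ) × ℝ → ℂ) :
    (Fin n → ℝ) × ℝ → ℂ :=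
  (List.finRange (n + 1)).foldr (fun i g => (pdir (edir n i))^[γ i] g) f

/-- The Laplacian on `ℝ^{n+1}`, as an operator on functions. -/
def lapP {n : ℕ} (f : (Fin n → ℝ) × ℝ → ℂ) : (Fin n → ℝ) × ℝ → ℂ :=
  fun p => ∑ i : Fin (n + 1), pdir (edir n i) (pdir (edir n i) f) p

/-- Test functions for an open set `Ω`: smooth, compactly supported inside `Ω`. -/
def IsTest {n : ℕ} (Ω : Set ((Fin n → ℝ) × ℝ)) (φ : (Fin n → ℝ) × ℝ → ℂ) : Prop :=
  ContDiff ℝ (⊤ : ℕ∞) φ ∧ HasCompactSupport φ ∧ tsupport φ ⊆ Ω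

/-- `v` is the weak derivative `∂^γ u` on `Ω`. -/
def IsWeakDeriv {n : ℕ} (Ω : Set ((Fin n → ℝ) × ℝ)) (γ : Fin (n + 1) → ℕ)
    (u v : (Fin n → ℝ) × ℝ → ℂ) : Prop :=
  ∀ φ, IsTest Ω φ →
    ∫ p in Ω, u p * mpd γ φ p = (-1 : ℂ) ^ (∑ i, γ i) * ∫ p in Ω, v p * φ p

/-- The finset of multiindices in `ℕ^{n+1}` of length `m`. -/
def MI (n m : ℕ) : Finset (Fin (n + 1) → ℕ) := Finset.Nat.antidiagonalTuple (n + 1) m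

/-- Coefficients of a divergence form operator of order `2m` on `ℝ^{n+1}`. -/
abbrev Coef (n : ℕ) := (Fin (n + 1) → ℕ) → (Fin (n + 1) → ℕ) → (Fin n → ℝ) × ℝ → ℂ

/-- All coefficients are measurable. -/
def CoefMeasurable {n : ℕ} (A : Coef n) : Prop := ∀ α β, Measurable (A α β)

/-- The coefficients are (essentially) bounded by `Λ`. -/
def CoefBounded {n : ℕ} (m : ℕ) (A : Coef n) (Λ : ℝ) : Prop :=
  ∀ α ∈ MI n m, ∀ β ∈ MI n m, ∀ᵐ p : (Fin n → ℝ) × ℝ, ‖A α β p‖ ≤ Λ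

/-- The Gårding inequality with constant `lam`. -/
def Garding {n : ℕ} (m : ℕ) (A : Coef n) (lam : ℝ) : Prop :=
  ∀ φ : (Fin n → ℝ) × ℝ → ℂ, ContDiff ℝ (⊤ : ℕ∞) φ → HasCompactSupport φ →
    lam * ∑ α ∈ MI n m, ∫ p, ‖mpd α φ p‖ ^ 2 ≤
      (∑ α ∈ MI n m, ∑ β ∈ MI n m,
        ∫ p, (starRingEnd ℂ) (mpd α φ p) * A α β p * mpd β φ p).re

/-- `du` is a family of measurable weak derivatives of `u` up to order `m` on `Ω`. -/
def HasWDerivs {n : ℕ} (Ω : Set ((Fin n → ℝ) × ℝ)) (m : ℕ)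
    (u : (Fin n → ℝ) × ℝ → ℂ) (du : (Fin (n + 1) → ℕ) → (Fin n → ℝ) × ℝ → ℂ) : Prop :=
  du (fun _ => 0) = u ∧
    ∀ γ : Fin (n + 1) → ℕ, (∑ i, γ i) ≤ m →
      Measurable (du γ) ∧ IsWeakDeriv Ω γ u (du γ)

/-- The weak derivative `∂^β (Δ^M H)`, computed from the weak derivatives `dH` of `H`
via the multinomial expansion `∂^β Δ^M H = Σ_{|ζ|=M} (M!/ζ!) ∂^{β+2ζ} H`. -/
def wLapPow {n : ℕ} (M : ℕ) (dH : (Fin (n + 1) → ℕ) → (Fin n → ℝ) × ℝ → ℂ)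
    (β : Fin (n + 1) → ℕ) : (Fin n → ℝ) × ℝ → ℂ :=
  fun p => ∑ ζ ∈ MI n M, (Nat.multinomial Finset.univ ζ : ℂ) *
    dH (fun i => β i + 2 * ζ i) p

/-- The lower half space `ℝ^{n+1}_− = ℝⁿ × (−∞,0)`. -/
def lowerHalf (n : ℕ) : Set ((Fin n → ℝ) × ℝ) := {p | p.2 < 0}

section FourierSide

open SchwartzMap FourierTransform
open scoped ContDiff

variable {E : Type*} [NormedAddCommGroup E] [InnerProductSpace ℝ E]

/-- The symbol of the derivative in direction `v`. -/
def dirSymbol (v : E) : E → ℂ := fun ξ => 2 * Real.pi * Complex.I * (inner ℝ ξ v : ℝ)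

theorem continuous_dirSymbol (v : E) : Continuous (dirSymbol v) := by
  unfold dirSymbol; fun_prop

theorem conj_dirSymbol (v ξ : E) : (starRingEnd ℂ) (dirSymbol v ξ) = -dirSymbol v ξ := by
  simp only [dirSymbol, map_mul, Complex.conj_ofReal, Complex.conj_I, Complex.conj_ofNat]
  ring

theorem dirSymbol_eq_zero_iff {v ξ : E} : dirSymbol v ξ = 0 ↔ inner ℝ ξ v = 0 := by
  simp [dirSymbol, Real.pi_ne_zero]

variable [FiniteDimensional ℝ E]

/-- Compactly supported smooth functions are dense in the Schwartz space. -/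
theorem SchwartzMap.dense_hasCompactSupport :
    Dense {f : 𝓢(E, ℂ) | HasCompactSupport f} := by
  intro ψ
  let χ : ContDiffBump (0 : E) := ⟨1, 2, one_pos, one_lt_two⟩
  let c : ℕ → ℝ := fun N => ((N : ℝ) + 1)⁻¹
  have hc0 : ∀ N, 0 < c N := fun N => by positivity
  have hc1 : ∀ N, c N ≤ 1 := fun N => inv_le_one_of_one_le₀ (by linarith [N.cast_nonneg (α := ℝ)])
  let χN : ℕ → E → ℝ := fun N x => χ (c N • x)
  have hχN : ∀ N, ContDiff ℝ ∞ (χN N) := fun N => χ.contDiff.comp (contDiff_const_smul (c N))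
  have hχNc : ∀ N, HasCompactSupport (χN N) := fun N =>
    χ.hasCompactSupport.comp_smul (hc0 N).ne'
  have hχNt : ∀ N, (χN N).HasTemperateGrowth := fun N => (hχNc N).hasTemperateGrowth (hχN N)
  have hbd : ∀ i : ℕ, ∃ B : ℝ, 0 ≤ B ∧ ∀ N x, ‖iteratedFDeriv ℝ i (χN N) x‖ ≤ B := by
    intro i
    have hcont : Continuous (iteratedFDeriv ℝ i (χ : E → ℝ)) :=
      (χ.contDiff (n := (i : ℕ∞))).continuous_iteratedFDeriv (by simp)
    obtain ⟨B, hB⟩ := hcont.bounded_above_of_compact_support (χ.hasCompactSupport.iteratedFDeriv i)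
    refine ⟨B, (norm_nonneg _).trans (hB 0), fun N x => ?_⟩
    have := congrFun (iteratedFDeriv_comp_const_smul (𝕜 := ℝ) (i := i) (c N)
      (χ.contDiff : ContDiff ℝ (i : ℕ) (χ : E → ℝ))) x
    rw [show χN N = fun x => χ (c N • x) from rfl, this, norm_smul, norm_pow, Real.norm_eq_abs,
      abs_of_pos (hc0 N)]
    calc c N ^ i * _ ≤ 1 * B :=
          mul_le_mul (pow_le_one₀ (hc0 N).le (hc1 N)) (hB _) (norm_nonneg _) zero_le_one
      _ = B := one_mul B
  choose B hB0 hB using hbd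
  let fN : ℕ → 𝓢(E, ℂ) := fun N => smulLeftCLM ℂ (χN N) ψ
  have hfN : ∀ N, (fN N : E → ℂ) = fun x => χN N x • ψ x := fun N => smulLeftCLM_apply (hχNt N) ψ
  refine mem_closure_of_tendsto (b := Filter.atTop) (f := fN) ?_
    (Filter.Eventually.of_forall fun N => ?_)
  swap
  · change HasCompactSupport (fN N : E → ℂ)
    rw [hfN]
    exact (hχNc N).smul_right
  rw [(schwartz_withSeminorms ℝ E ℂ).tendsto_nhds]
  rintro ⟨k, n⟩ ε hε
  let D : ℝ := (∑ i ∈ Finset.range (n + 1), (n.choose i : ℝ) * B i *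
    SchwartzMap.seminorm ℝ (k + 1) (n - i) ψ) + SchwartzMap.seminorm ℝ (k + 1) n ψ
  have hD : 0 ≤ D := add_nonneg (Finset.sum_nonneg fun i _ =>
    mul_nonneg (mul_nonneg (by positivity) (hB0 i)) (apply_nonneg _ _)) (apply_nonneg _ _)
  have key : ∀ N, SchwartzMap.seminorm ℝ k n (fN N - ψ) ≤ c N * D := by
    intro N
    refine SchwartzMap.seminorm_le_bound ℝ k n _ (mul_nonneg (hc0 N).le hD) fun x => ?_
    by_cases hx : c N * ‖x‖ < 1
    · have hev : ((fN N - ψ : 𝓢(E, ℂ)) : E → ℂ) =ᶠ[nhds x] 0 := by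
        have ho : IsOpen {y : E | c N * ‖y‖ < 1} :=
          isOpen_lt (by fun_prop) continuous_const
        filter_upwards [ho.mem_nhds hx] with y hy
        have h1 : χN N y = 1 := χ.one_of_mem_closedBall (by
          simp only [mem_closedBall_zero_iff, norm_smul, Real.norm_eq_abs, abs_of_pos (hc0 N)]
          exact le_of_lt hy)
        simp [hfN, h1]
      rw [(hev.iteratedFDeriv ℝ n).eq_of_nhds]
      rw [show iteratedFDeriv ℝ n (0 : E → ℂ) x = 0 from
        congrFun iteratedFDeriv_fun_zero x, norm_zero, mul_zero]
      exact mul_nonneg (hc0 N).le hD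
    · have h1 : ‖iteratedFDeriv ℝ n (fN N - ψ : 𝓢(E, ℂ)) x‖ ≤
          (∑ i ∈ Finset.range (n + 1), (n.choose i : ℝ) * B i *
            ‖iteratedFDeriv ℝ (n - i) ψ x‖) + ‖iteratedFDeriv ℝ n ψ x‖ := by
        have e : ((fN N - ψ : 𝓢(E, ℂ)) : E → ℂ) = (fN N : E → ℂ) - ψ := rfl
        rw [e, iteratedFDeriv_sub ((fN N).smooth n) (ψ.smooth n)]
        refine (norm_sub_le _ _).trans (add_le_add ?_ le_rfl)
        rw [hfN]
        refine (norm_iteratedFDeriv_smul_le (hχN N) (ψ.smooth ⊤) x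
          (mod_cast le_top)).trans ?_
        gcongr with i hi
        exact hB i N x
      push Not at hx
      calc ‖x‖ ^ k * ‖iteratedFDeriv ℝ n (fN N - ψ : 𝓢(E, ℂ)) x‖
          ≤ (c N * ‖x‖) * (‖x‖ ^ k * ‖iteratedFDeriv ℝ n (fN N - ψ : 𝓢(E, ℂ)) x‖) :=
            le_mul_of_one_le_left (by positivity) hx
        _ = c N * (‖x‖ ^ (k + 1) * ‖iteratedFDeriv ℝ n (fN N - ψ : 𝓢(E, ℂ)) x‖) := by ring
        _ ≤ c N * (‖x‖ ^ (k + 1) * ((∑ i ∈ Finset.range (n + 1), (n.choose i : ℝ) * B i *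
            ‖iteratedFDeriv ℝ (n - i) ψ x‖) + ‖iteratedFDeriv ℝ n ψ x‖)) := by
            gcongr
        _ = c N * ((∑ i ∈ Finset.range (n + 1), (n.choose i : ℝ) * B i *
            (‖x‖ ^ (k + 1) * ‖iteratedFDeriv ℝ (n - i) ψ x‖)) +
              ‖x‖ ^ (k + 1) * ‖iteratedFDeriv ℝ n ψ x‖) := by
            rw [mul_add, Finset.mul_sum]
            congr 2
            exact Finset.sum_congr rfl fun i _ => by ring
        _ ≤ c N * D := by
            refine mul_le_mul_of_nonneg_left (add_le_add (Finset.sum_le_sum fun i _ => ?_) ?_)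
              (hc0 N).le
            · exact mul_le_mul_of_nonneg_left (SchwartzMap.le_seminorm ℝ _ _ ψ x)
                (mul_nonneg (by positivity) (hB0 i))
            · exact SchwartzMap.le_seminorm ℝ _ _ ψ x
  have hlim : Filter.Tendsto (fun N => c N * D) Filter.atTop (nhds 0) := by
    simpa [c, one_div] using (tendsto_one_div_add_atTop_nhds_zero_nat (𝕜 := ℝ)).mul_const D
  filter_upwards [hlim.eventually (gt_mem_nhds hε)] with N hN
  exact (key N).trans_lt hN

variable [MeasurableSpace E] [BorelSpace E]

/-- `T` acts on the Fourier side as multiplication by the function `σ`. -/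
def HasSymbol (T : 𝓢(E, ℂ) →L[ℂ] 𝓢(E, ℂ)) (σ : E → ℂ) : Prop :=
  ∀ φ ξ, 𝓕 (T φ) ξ = σ ξ * 𝓕 φ ξ

theorem HasSymbol.id : HasSymbol (ContinuousLinearMap.id ℂ 𝓢(E, ℂ)) 1 := fun φ ξ => by simp

theorem HasSymbol.comp {T S : 𝓢(E, ℂ) →L[ℂ] 𝓢(E, ℂ)} {σ τ : E → ℂ} (hT : HasSymbol T σ)
    (hS : HasSymbol S τ) : HasSymbol (T ∘L S) (σ * τ) := fun φ ξ => by
  rw [ContinuousLinearMap.comp_apply, hT, hS, Pi.mul_apply, mul_assoc]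

theorem HasSymbol.pow {T : 𝓢(E, ℂ) →L[ℂ] 𝓢(E, ℂ)} {σ : E → ℂ} (hT : HasSymbol T σ) (k : ℕ) :
    HasSymbol (T ^ k) (σ ^ k) := by
  induction k with
  | zero => rw [pow_zero, pow_zero]; exact HasSymbol.id
  | succ k ih => rw [pow_succ, pow_succ]; exact ih.comp hT

theorem HasSymbol.sum {ι : Type*} {s : Finset ι} {T : ι → 𝓢(E, ℂ) →L[ℂ] 𝓢(E, ℂ)}
    {σ : ι → E → ℂ} (hT : ∀ i, HasSymbol (T i) (σ i)) :
    HasSymbol (∑ i ∈ s, T i) (∑ i ∈ s, σ i) := fun φ ξ => by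
  have h : 𝓕 (∑ i ∈ s, T i φ) = ∑ i ∈ s, 𝓕 (T i φ) :=
    map_sum (fourierCLM ℂ 𝓢(E, ℂ)) (fun i => T i φ) s
  rw [_root_.sum_apply, h, _root_.sum_apply, Finset.sum_apply, Finset.sum_mul]
  exact Finset.sum_congr rfl fun i _ => hT i φ ξ

theorem hasSymbol_lineDeriv (v : E) :
    HasSymbol (LineDeriv.lineDerivOpCLM ℂ 𝓢(E, ℂ) v) (dirSymbol v) := fun φ ξ => by
  have : (inner ℝ · v : E → ℝ).HasTemperateGrowth := ((innerSL ℝ).flip v).hasTemperateGrowth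
  rw [LineDeriv.lineDerivOpCLM_apply, SchwartzMap.fourier_lineDerivOp_eq]
  simp [smulLeftCLM_apply_apply this, dirSymbol, mul_assoc]

/-- A linear relation between derivatives of `L²` functions, tested against compactly supported
smooth functions, is a pointwise relation between their Fourier transforms. -/
theorem sum_conj_symbol_mul_fourier_eq_zero {ι : Type*} (s : Finset ι)
    (T : ι → 𝓢(E, ℂ) →L[ℂ] 𝓢(E, ℂ)) (σ : ι → E → ℂ) (hT : ∀ j, HasSymbol (T j) (σ j))
    (hσ : ∀ j, Continuous (σ j)) (f : ι → Lp ℂ 2 (volume : Measure E))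
    (h : ∀ φ : 𝓢(E, ℂ), HasCompactSupport φ →
      ∑ j ∈ s, inner ℂ ((T j φ).toLp 2) (f j) = 0) :
    ∀ᵐ ξ, ∑ j ∈ s, (starRingEnd ℂ) (σ j ξ) * (𝓕 (f j) : Lp ℂ 2 (volume : Measure E)) ξ = 0 := by
  have h' : ∀ φ : 𝓢(E, ℂ), ∑ j ∈ s, inner ℂ ((T j φ).toLp 2) (f j) = 0 := by
    have hclosed : IsClosed {φ : 𝓢(E, ℂ) | ∑ j ∈ s, inner ℂ ((T j φ).toLp 2) (f j) = 0} := by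
      refine isClosed_eq (continuous_finsetSum _ fun j _ => ?_) continuous_const
      exact Continuous.inner ((toLpCLM ℂ ℂ 2 (volume : Measure E)).continuous.comp
        (T j).continuous) continuous_const
    exact fun φ => hclosed.closure_subset_iff.2 h (SchwartzMap.dense_hasCompactSupport φ)
  have hloc : ∀ j, LocallyIntegrable
      (fun ξ => (starRingEnd ℂ) (σ j ξ) * (𝓕 (f j) : Lp ℂ 2 (volume : Measure E)) ξ) := fun j => by
    rw [← locallyIntegrableOn_univ]
    exact LocallyIntegrableOn.continuousOn_mul
      (locallyIntegrableOn_univ.2 ((Lp.memLp (𝓕 (f j))).locallyIntegrable one_le_two))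
      (Complex.continuous_conj.comp (hσ j)).continuousOn isOpen_univ.isLocallyClosed
  refine ae_eq_zero_of_integral_contDiff_smul_eq_zero
    (locallyIntegrable_finsetSum s fun j _ => hloc j) fun g hg hgc => ?_
  have hg₁ : HasCompactSupport (Complex.ofRealCLM ∘ g) := hgc.comp_left rfl
  have hg₂ : ContDiff ℝ ∞ (Complex.ofRealCLM ∘ g) := by fun_prop
  let G : 𝓢(E, ℂ) := hg₁.toSchwartzMap hg₂
  have hG : ∀ ξ, G ξ = (g ξ : ℂ) := fun ξ => rfl
  have hterm : ∀ j, inner ℂ ((T j (𝓕⁻ G)).toLp 2) (f j) =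
      ∫ ξ, g ξ • ((starRingEnd ℂ) (σ j ξ) * (𝓕 (f j) : Lp ℂ 2 (volume : Measure E)) ξ) := by
    intro j
    rw [← Lp.inner_fourier_eq, SchwartzMap.toLp_fourier_eq, L2.inner_def]
    refine integral_congr_ae ?_
    filter_upwards [SchwartzMap.coeFn_toLp (𝓕 (T j (𝓕⁻ G))) 2] with ξ hξ
    rw [hξ, hT j, FourierTransform.fourier_fourierInv_eq, hG]
    simp [RCLike.inner_apply]
    ring
  have := h' (𝓕⁻ G)
  simp_rw [hterm] at this
  rw [← integral_finsetSum] at this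
  · simpa only [Finset.smul_sum] using this
  · exact fun j _ => (hloc j).integrable_smul_left_of_hasCompactSupport hg.continuous hgc

end FourierSide

section Transport

open SchwartzMap FourierTransform
open scoped ContDiff

theorem edir_ne_zero (n : ℕ) (i : Fin (n + 1)) : edir n i ≠ 0 := by
  unfold edir
  split_ifs with h
  · intro h0
    have := congrFun (congrArg Prod.fst h0) ⟨i, h⟩
    simp at this
  · simp

/-- The space `ℝ^{n+1}` with its Euclidean structure. -/
abbrev EucProd (n : ℕ) : Type := WithLp 2 (EuclideanSpace ℝ (Fin n) × ℝ)

/-- The identification of `ℝ^{n+1}` with its Euclidean structure and `ℝⁿ × ℝ`. -/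
def eucEquiv (n : ℕ) : EucProd n ≃L[ℝ] (Fin n → ℝ) × ℝ :=
  (WithLp.prodContinuousLinearEquiv 2 ℝ (EuclideanSpace ℝ (Fin n)) ℝ).trans
    ((EuclideanSpace.equiv (Fin n) ℝ).prodCongr (ContinuousLinearEquiv.refl ℝ ℝ))

theorem measurePreserving_eucEquiv (n : ℕ) : MeasurePreserving (eucEquiv n) :=
  ((PiLp.volume_preserving_ofLp (Fin n)).prod (MeasurePreserving.id volume)).comp
    (WithLp.volume_preserving_ofLp (EuclideanSpace ℝ (Fin n)) ℝ)

theorem measurePreserving_eucEquiv_symm (n : ℕ) : MeasurePreserving (eucEquiv n).symm :=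
  (measurePreserving_eucEquiv n).symm (eucEquiv n).toHomeomorph.toMeasurableEquiv

/-- The `i`-th partial derivative on Schwartz functions. -/
def partialS (n : ℕ) (i : Fin (n + 1)) : 𝓢(EucProd n, ℂ) →L[ℂ] 𝓢(EucProd n, ℂ) :=
  LineDeriv.lineDerivOpCLM ℂ 𝓢(EucProd n, ℂ) ((eucEquiv n).symm (edir n i))

/-- The higher partial derivative `∂^γ` on Schwartz functions. -/
def mpdS {n : ℕ} (γ : Fin (n + 1) → ℕ) : 𝓢(EucProd n, ℂ) →L[ℂ] 𝓢(EucProd n, ℂ) :=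
  (List.finRange (n + 1)).foldr (fun i T => (partialS n i ^ γ i) ∘L T) (.id ℂ _)

/-- The Laplacian on Schwartz functions. -/
def lapS (n : ℕ) : 𝓢(EucProd n, ℂ) →L[ℂ] 𝓢(EucProd n, ℂ) :=
  ∑ i, partialS n i ∘L partialS n i

/-- The symbol of the `i`-th partial derivative. -/
def partialSymbol (n : ℕ) (i : Fin (n + 1)) : EucProd n → ℂ :=
  dirSymbol ((eucEquiv n).symm (edir n i))

/-- The symbol of `∂^γ`. -/
def mpdSymbol {n : ℕ} (γ : Fin (n + 1) → ℕ) : EucProd n → ℂ := ∏ i, partialSymbol n i ^ γ i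

/-- The symbol of the Laplacian. -/
def lapSymbol (n : ℕ) : EucProd n → ℂ := ∑ i, partialSymbol n i * partialSymbol n i

theorem continuous_partialSymbol (n : ℕ) (i : Fin (n + 1)) : Continuous (partialSymbol n i) :=
  continuous_dirSymbol _

theorem continuous_mpdSymbol {n : ℕ} (γ : Fin (n + 1) → ℕ) : Continuous (mpdSymbol γ) :=
  Finset.prod_induction _ Continuous (fun _ _ => Continuous.mul) continuous_one fun i _ =>
    (continuous_partialSymbol n i).pow _

theorem continuous_lapSymbol (n : ℕ) : Continuous (lapSymbol n) :=
  Finset.sum_induction _ Continuous (fun _ _ => Continuous.add) continuous_zero fun i _ =>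
    (continuous_partialSymbol n i).mul (continuous_partialSymbol n i)

theorem hasSymbol_partialS (n : ℕ) (i : Fin (n + 1)) :
    HasSymbol (partialS n i) (partialSymbol n i) := hasSymbol_lineDeriv _

theorem hasSymbol_mpdS {n : ℕ} (γ : Fin (n + 1) → ℕ) : HasSymbol (mpdS γ) (mpdSymbol γ) := by
  have key : ∀ l : List (Fin (n + 1)),
      HasSymbol (l.foldr (fun i T => (partialS n i ^ γ i) ∘L T) (.id ℂ 𝓢(EucProd n, ℂ)))
        (l.map fun i => partialSymbol n i ^ γ i).prod := by
    intro l
    induction l with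
    | nil => exact HasSymbol.id
    | cons i l ih =>
      rw [List.map_cons, List.prod_cons, List.foldr_cons]
      exact ((hasSymbol_partialS n i).pow (γ i)).comp ih
  rw [mpdSymbol, Fin.prod_univ_def]
  exact key _

theorem hasSymbol_lapS (n : ℕ) : HasSymbol (lapS n) (lapSymbol n) :=
  HasSymbol.sum fun i => (hasSymbol_partialS n i).comp (hasSymbol_partialS n i)

theorem conj_partialSymbol {n : ℕ} (i : Fin (n + 1)) (ξ : EucProd n) :
    (starRingEnd ℂ) (partialSymbol n i ξ) = -partialSymbol n i ξ := conj_dirSymbol _ ξ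

theorem conj_mpdSymbol {n : ℕ} (γ : Fin (n + 1) → ℕ) (ξ : EucProd n) :
    (starRingEnd ℂ) (mpdSymbol γ ξ) = (-1) ^ (∑ i, γ i) * mpdSymbol γ ξ := by
  simp only [mpdSymbol, Finset.prod_apply, Pi.pow_apply, map_prod, map_pow, conj_partialSymbol]
  rw [← Finset.prod_pow_eq_pow_sum, ← Finset.prod_mul_distrib]
  exact Finset.prod_congr rfl fun i _ => neg_pow _ _

theorem ae_partialSymbol_ne_zero (n : ℕ) :
    ∀ᵐ ξ : EucProd n, ∀ i, partialSymbol n i ξ ≠ 0 := by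
  rw [ae_all_iff]
  intro i
  set v : EucProd n := (eucEquiv n).symm (edir n i) with hv
  have hv0 : v ≠ 0 := by
    rw [hv, Ne, EmbeddingLike.map_eq_zero_iff]
    exact edir_ne_zero n i
  have hne : (ℝ ∙ v)ᗮ ≠ ⊤ := by
    rw [Ne, Submodule.orthogonal_eq_top_iff, Submodule.span_singleton_eq_bot]
    exact hv0
  have hnull := Measure.addHaar_submodule (volume : Measure (EucProd n)) _ hne
  filter_upwards [measure_eq_zero_iff_ae_notMem.1 hnull] with ξ hξ h0
  apply hξ
  rw [SetLike.mem_coe, Submodule.mem_orthogonal_singleton_iff_inner_left]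
  exact dirSymbol_eq_zero_iff.1 h0

theorem mpdSymbol_ne_zero {n : ℕ} (γ : Fin (n + 1) → ℕ) {ξ : EucProd n}
    (h : ∀ i, partialSymbol n i ξ ≠ 0) : mpdSymbol γ ξ ≠ 0 := by
  rw [mpdSymbol, Finset.prod_apply]
  exact Finset.prod_ne_zero_iff.2 fun i _ => pow_ne_zero _ (h i)

theorem lapSymbol_ne_zero {n : ℕ} {ξ : EucProd n}
    (h : ∀ i, partialSymbol n i ξ ≠ 0) : lapSymbol n ξ ≠ 0 := by
  have hsq : ∀ i, partialSymbol n i ξ * partialSymbol n i ξ =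
      -((‖partialSymbol n i ξ‖ ^ 2 : ℝ) : ℂ) := fun i => by
    push_cast
    rw [← Complex.mul_conj', conj_partialSymbol]
    ring
  simp only [lapSymbol, Finset.sum_apply, Pi.mul_apply, hsq]
  rw [Finset.sum_neg_distrib, neg_ne_zero, ← Complex.ofReal_sum, Complex.ofReal_ne_zero]
  exact (Finset.sum_pos (fun i _ => by have := h i; positivity) Finset.univ_nonempty).ne'

/-- Fields of `L²` functions which are formally gradients of order `m` are limits of the fields
`∇^m Δ^M ψ` with `ψ` smooth and compactly supported. -/
theorem exists_gradient_laplacian_approx {n : ℕ} (m M : ℕ)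
    (g : (Fin (n + 1) → ℕ) → Lp ℂ 2 (volume : Measure (EucProd n)))
    (hg : ∀ β ∈ MI n m, ∀ γ ∈ MI n m, ∀ ψ : 𝓢(EucProd n, ℂ), HasCompactSupport ψ →
      inner ℂ ((mpdS γ ψ).toLp 2) (g β) = inner ℂ ((mpdS β ψ).toLp 2) (g γ))
    {ε : ℝ} (hε : 0 < ε) :
    ∃ ψ : 𝓢(EucProd n, ℂ), HasCompactSupport ψ ∧
      ∀ β ∈ MI n m, ‖(mpdS β ((lapS n ^ M) ψ)).toLp 2 volume - g β‖ < ε := by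
  let X := PiLp 2 fun _ : MI n m => Lp ℂ 2 (volume : Measure (EucProd n))
  let K : Submodule ℂ 𝓢(EucProd n, ℂ) :=
    { carrier := {ψ | HasCompactSupport ψ}
      add_mem' := fun ha hb => ha.add hb
      zero_mem' := HasCompactSupport.zero
      smul_mem' := fun c _ ha => HasCompactSupport.smul_left (f := fun _ => c) ha }
  let D : 𝓢(EucProd n, ℂ) →ₗ[ℂ] X :=
    (WithLp.linearEquiv 2 ℂ _).symm.toLinearMap ∘ₗ LinearMap.pi fun β : MI n m =>
      ((toLpCLM ℂ ℂ 2 (volume : Measure (EucProd n))) ∘L mpdS β.1 ∘L (lapS n ^ M)).toLinearMap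
  have hD : ∀ ψ β, D ψ β = (mpdS β.1 ((lapS n ^ M) ψ)).toLp 2 := fun ψ β => rfl
  let G : X := WithLp.toLp 2 fun β : MI n m => g β.1
  have hG : ∀ β, G β = g β.1 := fun β => rfl
  have hmem : G ∈ (K.map D).topologicalClosure := by
    rw [← Submodule.orthogonal_orthogonal_eq_closure, Submodule.mem_orthogonal]
    intro h hh
    have hh' : ∀ᵐ ξ, ∑ β : MI n m, (starRingEnd ℂ) ((mpdSymbol β.1 * lapSymbol n ^ M) ξ) *
        (𝓕 (h β) : Lp ℂ 2 (volume : Measure (EucProd n))) ξ = 0 := by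
      refine sum_conj_symbol_mul_fourier_eq_zero Finset.univ
        (fun β : MI n m => mpdS β.1 ∘L (lapS n ^ M)) _
        (fun β => (hasSymbol_mpdS β.1).comp ((hasSymbol_lapS n).pow M))
        (fun β => (continuous_mpdSymbol _).mul ((continuous_lapSymbol n).pow M))
        (fun β => h β) fun ψ hψ => ?_
      have := (Submodule.mem_orthogonal _ _).1 hh (D ψ) (Submodule.mem_map_of_mem hψ)
      rw [PiLp.inner_apply] at this
      exact this
    have hgg : ∀ᵐ ξ, ∀ β γ : MI n m, (starRingEnd ℂ) (mpdSymbol γ.1 ξ) *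
        (𝓕 (g β.1) : Lp ℂ 2 (volume : Measure (EucProd n))) ξ =
          (starRingEnd ℂ) (mpdSymbol β.1 ξ) *
            (𝓕 (g γ.1) : Lp ℂ 2 (volume : Measure (EucProd n))) ξ := by
      rw [ae_all_iff]; intro β
      rw [ae_all_iff]; intro γ
      have := sum_conj_symbol_mul_fourier_eq_zero (Finset.univ : Finset Bool)
        (fun b => if b then mpdS γ.1 else mpdS β.1)
        (fun b => if b then mpdSymbol γ.1 else mpdSymbol β.1)
        (fun b => by cases b <;> simp [hasSymbol_mpdS])
        (fun b => by cases b <;> simp [continuous_mpdSymbol])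
        (fun b => if b then g β.1 else -g γ.1)
        (fun ψ hψ => by simp [hg β.1 β.2 γ.1 γ.2 ψ hψ])
      have hneg : 𝓕 (-g γ.1) = -𝓕 (g γ.1) := map_neg (Lp.fourierTransformₗᵢ (EucProd n) ℂ) _
      filter_upwards [this, Lp.coeFn_neg (𝓕 (g γ.1))] with ξ hξ hξ'
      simp only [Fintype.sum_bool, if_true, Bool.false_eq_true, if_false, hneg, hξ',
        Pi.neg_apply, mul_neg] at hξ
      exact add_neg_eq_zero.1 hξ
    rw [PiLp.inner_apply]
    have hint : ∀ β : MI n m, Integrable fun ξ =>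
        inner ℂ ((𝓕 (h β) : Lp ℂ 2 (volume : Measure (EucProd n))) ξ)
          ((𝓕 (g β.1) : Lp ℂ 2 (volume : Measure (EucProd n))) ξ) :=
      fun β => L2.integrable_inner _ _
    have hterm : ∀ β : MI n m, inner ℂ (h β) (G β) =
        ∫ ξ, inner ℂ ((𝓕 (h β) : Lp ℂ 2 (volume : Measure (EucProd n))) ξ)
          ((𝓕 (g β.1) : Lp ℂ 2 (volume : Measure (EucProd n))) ξ) := fun β => by
      rw [hG, ← Lp.inner_fourier_eq, L2.inner_def]
    simp_rw [hterm]
    rw [← integral_finsetSum _ fun β _ => hint β]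
    refine integral_eq_zero_of_ae ?_
    filter_upwards [hh', hgg, ae_partialSymbol_ne_zero n] with ξ h1 h2 h3
    rw [Pi.zero_apply]
    rcases isEmpty_or_nonempty (MI n m) with hem | ⟨⟨γ⟩⟩
    · simp
    · have hγ := mpdSymbol_ne_zero γ.1 h3
      have hlap := pow_ne_zero M (lapSymbol_ne_zero h3)
      have h4 : ∑ β : MI n m, mpdSymbol β.1 ξ *
          (starRingEnd ℂ) ((𝓕 (h β) : Lp ℂ 2 (volume : Measure (EucProd n))) ξ) = 0 := by
        have := congrArg (starRingEnd ℂ) h1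
        simp only [map_sum, map_mul, Complex.conj_conj, map_zero, Pi.mul_apply, Pi.pow_apply] at this
        refine (mul_eq_zero.1 ?_).resolve_left hlap
        rw [Finset.mul_sum, ← this]
        exact Finset.sum_congr rfl fun β _ => by ring
      have hdeg : ∀ β : MI n m, ∑ i, β.1 i = m := fun β => Finset.Nat.mem_antidiagonalTuple.1 β.2
      refine (mul_eq_zero.1 ?_).resolve_left hγ
      rw [Finset.mul_sum, ← mul_zero ((𝓕 (g γ.1) : Lp ℂ 2 (volume : Measure (EucProd n))) ξ), ← h4,
        Finset.mul_sum]
      refine Finset.sum_congr rfl fun β _ => ?_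
      have h5 := h2 β γ
      rw [conj_mpdSymbol, conj_mpdSymbol, hdeg, hdeg, mul_assoc, mul_assoc] at h5
      have h6 := mul_left_cancel₀ (pow_ne_zero m (neg_ne_zero.2 one_ne_zero)) h5
      rw [RCLike.inner_apply]
      linear_combination (starRingEnd ℂ)
        ((𝓕 (h β) : Lp ℂ 2 (volume : Measure (EucProd n))) ξ) * h6
  obtain ⟨_, ⟨ψ, hψ, rfl⟩, hdist⟩ := Metric.mem_closure_iff.1 hmem ε hε
  refine ⟨ψ, hψ, fun β hβ => ?_⟩
  have h1 := PiLp.norm_apply_le (D ψ - G) ⟨β, hβ⟩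
  rw [← dist_eq_norm, dist_comm] at h1
  exact h1.trans_lt hdist

end Transport

section TestFunctions

open SchwartzMap FourierTransform
open scoped ContDiff

/-- The Schwartz function `ψ` is the function `φ` read in Euclidean coordinates. -/
def Represents {n : ℕ} (ψ : 𝓢(EucProd n, ℂ)) (φ : (Fin n → ℝ) × ℝ → ℂ) : Prop :=
  (ψ : EucProd n → ℂ) = φ ∘ eucEquiv n

variable {n : ℕ}

theorem Represents.eq_comp_symm {ψ : 𝓢(EucProd n, ℂ)} {φ : (Fin n → ℝ) × ℝ → ℂ}
    (h : Represents ψ φ) : φ = ψ ∘ (eucEquiv n).symm := by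
  rw [h]; ext p; simp

theorem represents_comp_symm (ψ : 𝓢(EucProd n, ℂ)) : Represents ψ (ψ ∘ (eucEquiv n).symm) := by
  ext x; simp

theorem exists_represents {φ : (Fin n → ℝ) × ℝ → ℂ} (h : ContDiff ℝ ∞ φ)
    (hc : HasCompactSupport φ) :
    ∃ ψ : 𝓢(EucProd n, ℂ), HasCompactSupport ψ ∧ Represents ψ φ :=
  have hc' : HasCompactSupport (φ ∘ eucEquiv n) := hc.comp_homeomorph (eucEquiv n).toHomeomorph
  ⟨hc'.toSchwartzMap (h.comp (eucEquiv n).contDiff), hc', rfl⟩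

theorem Represents.contDiff {ψ : 𝓢(EucProd n, ℂ)} {φ : (Fin n → ℝ) × ℝ → ℂ}
    (h : Represents ψ φ) : ContDiff ℝ ∞ φ := by
  rw [h.eq_comp_symm]
  exact (ψ.smooth ⊤).comp (eucEquiv n).symm.contDiff

theorem Represents.hasCompactSupport {ψ : 𝓢(EucProd n, ℂ)} {φ : (Fin n → ℝ) × ℝ → ℂ}
    (h : Represents ψ φ) (hψ : HasCompactSupport ψ) : HasCompactSupport φ := by
  rw [h.eq_comp_symm]
  exact hψ.comp_homeomorph (eucEquiv n).symm.toHomeomorph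

theorem Represents.isTest {ψ : 𝓢(EucProd n, ℂ)} {φ : (Fin n → ℝ) × ℝ → ℂ}
    (h : Represents ψ φ) (hψ : HasCompactSupport ψ) : IsTest Set.univ φ :=
  ⟨h.contDiff, h.hasCompactSupport hψ, Set.subset_univ _⟩

theorem Represents.memLp {ψ : 𝓢(EucProd n, ℂ)} {φ : (Fin n → ℝ) × ℝ → ℂ}
    (h : Represents ψ φ) : MemLp φ 2 := by
  rw [h.eq_comp_symm]
  exact (ψ.memLp 2).comp_measurePreserving (measurePreserving_eucEquiv_symm n)

theorem Represents.toLp_eq {ψ : 𝓢(EucProd n, ℂ)} {φ : (Fin n → ℝ) × ℝ → ℂ}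
    (h : Represents ψ φ) :
    ψ.toLp 2 = Lp.compMeasurePreservingₗᵢ ℂ (eucEquiv n) (measurePreserving_eucEquiv n)
      (h.memLp.toLp φ) := by
  refine (MemLp.toLp_congr _ (h.memLp.comp_measurePreserving (measurePreserving_eucEquiv n))
    (Filter.EventuallyEq.of_eq h)).trans ?_
  exact (Lp.toLp_compMeasurePreserving h.memLp (measurePreserving_eucEquiv n)).symm

theorem Represents.pdir {ψ : 𝓢(EucProd n, ℂ)} {φ : (Fin n → ℝ) × ℝ → ℂ}
    (h : Represents ψ φ) (i : Fin (n + 1)) :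
    Represents (partialS n i ψ) (pdir (edir n i) φ) := by
  ext x
  rw [partialS, LineDeriv.lineDerivOpCLM_apply, SchwartzMap.lineDerivOp_apply_eq_fderiv, h,
    (eucEquiv n).comp_right_fderiv]
  simp [_root_.pdir]

theorem Represents.pdir_iterate {ψ : 𝓢(EucProd n, ℂ)} {φ : (Fin n → ℝ) × ℝ → ℂ}
    (h : Represents ψ φ) (i : Fin (n + 1)) (k : ℕ) :
    Represents ((partialS n i ^ k) ψ) ((_root_.pdir (edir n i))^[k] φ) := by
  induction k with
  | zero => exact h
  | succ k ih =>
    rw [pow_succ', Function.iterate_succ_apply']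
    exact ih.pdir i

theorem Represents.mpd {ψ : 𝓢(EucProd n, ℂ)} {φ : (Fin n → ℝ) × ℝ → ℂ}
    (h : Represents ψ φ) (γ : Fin (n + 1) → ℕ) : Represents (mpdS γ ψ) (mpd γ φ) := by
  unfold mpdS _root_.mpd
  induction List.finRange (n + 1) with
  | nil => exact h
  | cons i l ih => exact ih.pdir_iterate i (γ i)

theorem Represents.lapP {ψ : 𝓢(EucProd n, ℂ)} {φ : (Fin n → ℝ) × ℝ → ℂ}
    (h : Represents ψ φ) : Represents (lapS n ψ) (lapP φ) := by
  ext x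
  rw [lapS, _root_.sum_apply, _root_.sum_apply]
  exact Finset.sum_congr rfl fun i _ => congrFun ((h.pdir i).pdir i) x

theorem Represents.lapP_iterate {ψ : 𝓢(EucProd n, ℂ)} {φ : (Fin n → ℝ) × ℝ → ℂ}
    (h : Represents ψ φ) (k : ℕ) : Represents ((lapS n ^ k) ψ) (_root_.lapP^[k] φ) := by
  induction k with
  | zero => exact h
  | succ k ih =>
    rw [pow_succ', Function.iterate_succ_apply']
    exact ih.lapP

theorem hasCompactSupport_pdir {φ : (Fin n → ℝ) × ℝ → ℂ} (h : HasCompactSupport φ)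
    (v : (Fin n → ℝ) × ℝ) : HasCompactSupport (pdir v φ) := h.fderiv_apply ℝ v

theorem hasCompactSupport_mpd {φ : (Fin n → ℝ) × ℝ → ℂ} (h : HasCompactSupport φ)
    (γ : Fin (n + 1) → ℕ) : HasCompactSupport (mpd γ φ) := by
  unfold mpd
  induction List.finRange (n + 1) with
  | nil => exact h
  | cons i l ih =>
    rw [List.foldr_cons]
    generalize γ i = k
    induction k with
    | zero => exact ih
    | succ k ihk =>
      rw [Function.iterate_succ_apply']
      exact hasCompactSupport_pdir ihk _

theorem hasCompactSupport_lapP {φ : (Fin n → ℝ) × ℝ → ℂ} (h : HasCompactSupport φ) :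
    HasCompactSupport (lapP φ) := by
  have : lapP φ = ∑ i : Fin (n + 1), pdir (edir n i) (pdir (edir n i) φ) := by
    ext p; simp [lapP]
  rw [this]
  exact Finset.sum_induction _ HasCompactSupport (fun _ _ => HasCompactSupport.add)
    HasCompactSupport.zero fun i _ => hasCompactSupport_pdir (hasCompactSupport_pdir h _) _

theorem hasCompactSupport_lapP_iterate {φ : (Fin n → ℝ) × ℝ → ℂ} (h : HasCompactSupport φ)
    (k : ℕ) : HasCompactSupport (lapP^[k] φ) := by
  induction k with
  | zero => exact h
  | succ k ih =>
    rw [Function.iterate_succ_apply']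
    exact hasCompactSupport_lapP ih

theorem IsTest.mpd {φ : (Fin n → ℝ) × ℝ → ℂ} (h : IsTest Set.univ φ) (γ : Fin (n + 1) → ℕ) :
    IsTest Set.univ (mpd γ φ) := by
  obtain ⟨ψ, -, hψ⟩ := exists_represents h.1 h.2.1
  exact ⟨(hψ.mpd γ).contDiff, hasCompactSupport_mpd h.2.1 γ, Set.subset_univ _⟩

theorem IsTest.memLp_mpd {φ : (Fin n → ℝ) × ℝ → ℂ} (h : IsTest Set.univ φ)
    (γ : Fin (n + 1) → ℕ) : MemLp (_root_.mpd γ φ) 2 := by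
  obtain ⟨ψ, -, hψ⟩ := exists_represents h.1 h.2.1
  exact (hψ.mpd γ).memLp

theorem IsTest.conj {φ : (Fin n → ℝ) × ℝ → ℂ} (h : IsTest Set.univ φ) :
    IsTest Set.univ (fun p => (starRingEnd ℂ) (φ p)) :=
  ⟨Complex.conjCLE.contDiff.comp h.1, h.2.1.comp_left (map_zero _), Set.subset_univ _⟩

theorem pdir_conj (v : (Fin n → ℝ) × ℝ) (φ : (Fin n → ℝ) × ℝ → ℂ) :
    pdir v (fun p => (starRingEnd ℂ) (φ p)) = fun p => (starRingEnd ℂ) (pdir v φ p) := by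
  ext p
  have := Complex.conjCLE.comp_fderiv (f := φ) (x := p)
  exact congrArg (fun L : (Fin n → ℝ) × ℝ →L[ℝ] ℂ => L v) this

theorem mpd_conj (γ : Fin (n + 1) → ℕ) (φ : (Fin n → ℝ) × ℝ → ℂ) :
    mpd γ (fun p => (starRingEnd ℂ) (φ p)) = fun p => (starRingEnd ℂ) (mpd γ φ p) := by
  unfold mpd
  induction List.finRange (n + 1) with
  | nil => rfl
  | cons i l ih =>
    rw [List.foldr_cons, List.foldr_cons, ih]
    generalize γ i = k
    induction k with
    | zero => rfl
    | succ k ihk => rw [Function.iterate_succ_apply', ihk, pdir_conj, Function.iterate_succ_apply']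

theorem IsTest.mpd_mpd_eq {φ : (Fin n → ℝ) × ℝ → ℂ} (h : IsTest Set.univ φ)
    {α β γ δ : Fin (n + 1) → ℕ} (hab : α + β = γ + δ) :
    _root_.mpd α (_root_.mpd β φ) = _root_.mpd γ (_root_.mpd δ φ) := by
  obtain ⟨ψ, -, hψ⟩ := exists_represents h.1 h.2.1
  have hsymbol : ∀ α β : Fin (n + 1) → ℕ,
      (mpdSymbol α * mpdSymbol β : EucProd n → ℂ) = mpdSymbol (α + β) := fun α β => by
    simp only [mpdSymbol, ← Finset.prod_mul_distrib, ← pow_add, Pi.add_apply]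
  have hS : mpdS α (mpdS β ψ) = mpdS γ (mpdS δ ψ) := by
    refine (fourierEquiv ℂ 𝓢(EucProd n, ℂ)).injective (SchwartzMap.ext fun ξ => ?_)
    have h1 := (hasSymbol_mpdS α).comp (hasSymbol_mpdS β) ψ ξ
    have h2 := (hasSymbol_mpdS γ).comp (hasSymbol_mpdS δ) ψ ξ
    rw [hsymbol, hab] at h1
    rw [hsymbol] at h2
    exact h1.trans h2.symm
  rw [((hψ.mpd β).mpd α).eq_comp_symm, ((hψ.mpd δ).mpd γ).eq_comp_symm, hS]

end TestFunctions

section SquareIntegrable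

variable {X : Type*} [MeasurableSpace X] {μ : Measure X}

theorem memLp_two_of_lintegral_lt_top {f : X → ℂ} (hf : Measurable f)
    (h : (∫⁻ p, (‖f p‖₊ : ℝ≥0∞) ^ 2 ∂μ) < ⊤) : MemLp f 2 μ := by
  refine ⟨hf.aestronglyMeasurable, ?_⟩
  rw [eLpNorm_lt_top_iff_lintegral_rpow_enorm_lt_top two_ne_zero ofNat_ne_top]
  simpa [enorm] using h

theorem inner_toLp_toLp {f g : X → ℂ} (hf : MemLp f 2 μ) (hg : MemLp g 2 μ) :
    inner ℂ (hf.toLp f) (hg.toLp g) = ∫ p, (starRingEnd ℂ) (f p) * g p ∂μ := by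
  rw [L2.inner_def]
  refine integral_congr_ae ?_
  filter_upwards [hf.coeFn_toLp, hg.coeFn_toLp] with p h1 h2
  rw [h1, h2, RCLike.inner_apply, mul_comm]

theorem memLp_coef_mul {a g : X → ℂ} {K : ℝ} (ha : Measurable a) (hK : ∀ᵐ p ∂μ, ‖a p‖ ≤ K)
    (hg : MemLp g 2 μ) : MemLp (fun p => a p * g p) 2 μ := by
  refine hg.of_le_mul (c := K) (ha.aestronglyMeasurable.mul hg.1) ?_
  filter_upwards [hK] with p hp
  rw [norm_mul]
  exact mul_le_mul_of_nonneg_right hp (norm_nonneg _)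

theorem integrable_conj_mul_coef_mul {f a g : X → ℂ} {K : ℝ} (hf : MemLp f 2 μ)
    (ha : Measurable a) (hK : ∀ᵐ p ∂μ, ‖a p‖ ≤ K) (hg : MemLp g 2 μ) :
    Integrable (fun p => (starRingEnd ℂ) (f p) * a p * g p) μ := by
  have : MemLp (fun p => (starRingEnd ℂ) (f p)) 2 μ := hf.star
  simpa only [mul_assoc, Pi.mul_def] using MemLp.integrable_mul this (memLp_coef_mul ha hK hg)

theorem norm_integral_conj_mul_coef_mul_le {f a g : X → ℂ} {K : ℝ} (hf : MemLp f 2 μ)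
    (ha : Measurable a) (hK : ∀ᵐ p ∂μ, ‖a p‖ ≤ K) (hg : MemLp g 2 μ) :
    ‖∫ p, (starRingEnd ℂ) (f p) * a p * g p ∂μ‖ ≤ K * (‖hf.toLp f‖ * ‖hg.toLp g‖) := by
  have hag := memLp_coef_mul ha hK hg
  simp only [mul_assoc]
  rw [← inner_toLp_toLp hf hag]
  refine (norm_inner_le_norm _ _).trans ?_
  rw [mul_left_comm]
  refine mul_le_mul_of_nonneg_left ?_ (norm_nonneg _)
  refine Lp.norm_le_mul_norm_of_ae_le_mul ?_
  filter_upwards [hK, hag.coeFn_toLp, hg.coeFn_toLp] with p hp h1 h2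
  rw [h1, h2, norm_mul]
  exact mul_le_mul_of_nonneg_right hp (norm_nonneg _)

theorem norm_toLp_sq {f : X → ℂ} (hf : MemLp f 2 μ) :
    ‖hf.toLp f‖ ^ 2 = ∫ p, ‖f p‖ ^ 2 ∂μ := by
  have h := inner_toLp_toLp hf hf
  rw [inner_self_eq_norm_sq_to_K] at h
  simp only [Complex.conj_mul', ← Complex.ofReal_pow] at h
  rw [integral_complex_ofReal] at h
  exact Complex.ofReal_injective (by simpa using h)

end SquareIntegrable

section NewtonPotential

open SchwartzMap

variable {n : ℕ}

theorem sum_add_two_mul {m M : ℕ} {β ζ : Fin (n + 1) → ℕ} (hβ : β ∈ MI n m) (hζ : ζ ∈ MI n M) :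
    ∑ i, (β i + 2 * ζ i) = m + 2 * M := by
  rw [Finset.sum_add_distrib, ← Finset.mul_sum, Finset.Nat.mem_antidiagonalTuple.1 hβ,
    Finset.Nat.mem_antidiagonalTuple.1 hζ]

theorem IsWeakDeriv.integral_mul_mpd_eq {u v v' : (Fin n → ℝ) × ℝ → ℂ}
    {β γ β' γ' : Fin (n + 1) → ℕ} (h : IsWeakDeriv Set.univ β u v)
    (h' : IsWeakDeriv Set.univ γ' u v') (hsum : ∑ i, β i = ∑ i, γ' i) (hadd : β + γ = γ' + β')
    {θ : (Fin n → ℝ) × ℝ → ℂ} (hθ : IsTest Set.univ θ) :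
    ∫ p, v p * mpd γ θ p = ∫ p, v' p * mpd β' θ p := by
  have h1 := h _ (hθ.mpd γ)
  have h2 := h' _ (hθ.mpd β')
  rw [hθ.mpd_mpd_eq hadd, h2, hsum] at h1
  simpa using (mul_left_cancel₀ (pow_ne_zero _ (by norm_num)) h1).symm

theorem memLp_wLapPow {m M : ℕ} {w : (Fin n → ℝ) × ℝ → ℂ}
    {dw : (Fin (n + 1) → ℕ) → (Fin n → ℝ) × ℝ → ℂ} (hw : HasWDerivs Set.univ (m + 2 * M) w dw)
    (hwL2 : ∀ δ : Fin (n + 1) → ℕ, (∑ i, δ i) = m + 2 * M →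
      (∫⁻ p, (‖dw δ p‖₊ : ℝ≥0∞) ^ 2) < ⊤)
    {β : Fin (n + 1) → ℕ} (hβ : β ∈ MI n m) : MemLp (wLapPow M dw β) 2 := by
  refine memLp_finsetSum _ fun ζ hζ => MemLp.const_mul ?_ _
  have hsum := sum_add_two_mul hβ hζ
  exact memLp_two_of_lintegral_lt_top (hw.2 _ hsum.le).1 (hwL2 _ hsum)

theorem integral_wLapPow_mul_mpd_comm {m M : ℕ} {w : (Fin n → ℝ) × ℝ → ℂ}
    {dw : (Fin (n + 1) → ℕ) → (Fin n → ℝ) × ℝ → ℂ} (hw : HasWDerivs Set.univ (m + 2 * M) w dw)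
    (hwL2 : ∀ δ : Fin (n + 1) → ℕ, (∑ i, δ i) = m + 2 * M →
      (∫⁻ p, (‖dw δ p‖₊ : ℝ≥0∞) ^ 2) < ⊤)
    {β γ : Fin (n + 1) → ℕ} (hβ : β ∈ MI n m) (hγ : γ ∈ MI n m)
    {θ : (Fin n → ℝ) × ℝ → ℂ} (hθ : IsTest Set.univ θ) :
    ∫ p, wLapPow M dw β p * mpd γ θ p = ∫ p, wLapPow M dw γ p * mpd β θ p := by
  have expand : ∀ β ∈ MI n m, ∀ γ : Fin (n + 1) → ℕ,
      ∫ p, wLapPow M dw β p * mpd γ θ p = ∑ ζ ∈ MI n M, (Nat.multinomial Finset.univ ζ : ℂ) *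
        ∫ p, dw (fun i => β i + 2 * ζ i) p * mpd γ θ p := by
    intro β hβ γ
    simp only [wLapPow, Finset.sum_mul, mul_assoc]
    rw [integral_finsetSum]
    · simp only [integral_const_mul]
    · intro ζ hζ
      have hsum := sum_add_two_mul hβ hζ
      exact (MemLp.integrable_mul
        (memLp_two_of_lintegral_lt_top (hw.2 _ hsum.le).1 (hwL2 _ hsum))
        (hθ.memLp_mpd γ)).const_mul _
  rw [expand β hβ γ, expand γ hγ β]
  refine Finset.sum_congr rfl fun ζ hζ => congrArg _ ?_
  have hsβ := sum_add_two_mul hβ hζ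
  have hsγ := sum_add_two_mul hγ hζ
  refine (hw.2 _ hsβ.le).2.integral_mul_mpd_eq (hw.2 _ hsγ.le).2 (hsβ.trans hsγ.symm) ?_ hθ
  ext i
  simp only [Pi.add_apply]
  ring

/-- Square integrable functions `g β`, `|β| = m`, satisfying the compatibility conditions
`∂^γ g_β = ∂^β g_γ` in the weak sense are simultaneously approximated by the derivatives
`∂^β (Δ^M Φ)` of a single test function `Φ`. -/
theorem exists_test_mpd_lapP_approx (m M : ℕ) {g : (Fin (n + 1) → ℕ) → (Fin n → ℝ) × ℝ → ℂ}
    (hgL2 : ∀ β ∈ MI n m, MemLp (g β) 2)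
    (hg : ∀ β ∈ MI n m, ∀ γ ∈ MI n m, ∀ θ, IsTest Set.univ θ →
      ∫ p, g β p * mpd γ θ p = ∫ p, g γ p * mpd β θ p)
    {ε : ℝ} (hε : 0 < ε) :
    ∃ Φ : (Fin n → ℝ) × ℝ → ℂ, IsTest Set.univ Φ ∧ IsTest Set.univ (lapP^[M] Φ) ∧
      ∀ β ∈ MI n m, ∀ (hβ : MemLp (fun p => mpd β (lapP^[M] Φ) p - g β p) 2),
        ‖hβ.toLp‖ < ε := by
  classical
  let C := Lp.compMeasurePreservingₗᵢ (E := ℂ) (p := 2) ℂ (eucEquiv n)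
    (measurePreserving_eucEquiv n)
  let G : (Fin (n + 1) → ℕ) → Lp ℂ 2 (volume : Measure ((Fin n → ℝ) × ℝ)) := fun β =>
    if h : MemLp (g β) 2 then h.toLp else 0
  have hG : ∀ β (hβ : β ∈ MI n m), G β = (hgL2 β hβ).toLp := fun β hβ => dif_pos (hgL2 β hβ)
  obtain ⟨ψ, hψ, happrox⟩ := exists_gradient_laplacian_approx m M (fun β => C (G β)) (by
    intro β hβ γ hγ ψ hψ
    have hrep := represents_comp_symm ψ
    have key := hg β hβ γ hγ _ (hrep.isTest hψ).conj
    rw [(hrep.mpd γ).toLp_eq, (hrep.mpd β).toLp_eq]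
    refine ((C.inner_map_map _ _).trans ?_).trans (C.inner_map_map _ _).symm
    rw [hG β hβ, hG γ hγ, inner_toLp_toLp, inner_toLp_toLp]
    simpa only [mpd_conj, mul_comm] using key) hε
  have hrep := represents_comp_symm ψ
  have hlap := hrep.lapP_iterate M
  have htest := hrep.isTest hψ
  refine ⟨_, htest, ⟨hlap.contDiff, hasCompactSupport_lapP_iterate htest.2.1 M, Set.subset_univ _⟩,
    fun β hβ hmem => ?_⟩
  have h := happrox β hβ
  rw [(hlap.mpd β).toLp_eq, hG β hβ] at h
  change ‖C _ - C _‖ < ε at h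
  rw [← map_sub, C.norm_map, ← MemLp.toLp_sub] at h
  exact h

/-- If the coefficients satisfy the Gårding inequality and the bilinear form vanishes between a
test function `φ` and a family `g` that is `ε`-close to `∇^m φ`, then `g` is of size `O(ε)`. -/
theorem Garding.norm_toLp_le {m : ℕ} {A : Coef n} {lam Λ : ℝ} (hlam : 0 < lam)
    (hAmeas : CoefMeasurable A) (hAbd : CoefBounded m A Λ) (hAG : Garding m A lam)
    {g : (Fin (n + 1) → ℕ) → (Fin n → ℝ) × ℝ → ℂ} (hgL2 : ∀ β ∈ MI n m, MemLp (g β) 2)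
    {φ : (Fin n → ℝ) × ℝ → ℂ} (hφ : IsTest Set.univ φ)
    (horth : ∑ α ∈ MI n m, ∑ β ∈ MI n m,
      ∫ p, (starRingEnd ℂ) (mpd α φ p) * A α β p * g β p = 0)
    {ε : ℝ} (hε : 0 < ε)
    (hclose : ∀ β ∈ MI n m, ∀ (hβ : MemLp (fun p => mpd β φ p - g β p) 2), ‖hβ.toLp‖ < ε)
    {α : Fin (n + 1) → ℕ} (hα : α ∈ MI n m) :
    ‖(hgL2 α hα).toLp‖ ≤ ε * (1 + |Λ| * (#(MI n m) : ℝ) ^ 2 / lam) := by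
  set N : ℝ := ((#(MI n m) : ℕ) : ℝ) with hN
  let t : (Fin (n + 1) → ℕ) → ℝ := fun α => ‖(hφ.memLp_mpd α).toLp‖
  have ht : ∀ α, 0 ≤ t α := fun α => norm_nonneg _
  have hbd : ∀ α ∈ MI n m, ∀ β ∈ MI n m, ∀ᵐ p : (Fin n → ℝ) × ℝ, ‖A α β p‖ ≤ |Λ| :=
    fun α hα β hβ => (hAbd α hα β hβ).mono fun p hp => hp.trans (le_abs_self Λ)
  have hdiff : ∀ β ∈ MI n m, MemLp (fun p => mpd β φ p - g β p) 2 :=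
    fun β hβ => (hφ.memLp_mpd β).sub (hgL2 β hβ)
  have hform : ∑ α ∈ MI n m, ∑ β ∈ MI n m,
        ∫ p, (starRingEnd ℂ) (mpd α φ p) * A α β p * mpd β φ p =
      ∑ α ∈ MI n m, ∑ β ∈ MI n m,
        ∫ p, (starRingEnd ℂ) (mpd α φ p) * A α β p * (mpd β φ p - g β p) := by
    rw [← sub_zero (∑ α ∈ MI n m, _), ← horth, ← Finset.sum_sub_distrib]
    refine Finset.sum_congr rfl fun α hα => ?_
    rw [← Finset.sum_sub_distrib]
    refine Finset.sum_congr rfl fun β hβ => ?_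
    rw [← integral_sub]
    · simp only [mul_sub]
    · exact integrable_conj_mul_coef_mul (hφ.memLp_mpd α) (hAmeas α β) (hbd α hα β hβ)
        (hφ.memLp_mpd β)
    · exact integrable_conj_mul_coef_mul (hφ.memLp_mpd α) (hAmeas α β) (hbd α hα β hβ)
        (hgL2 β hβ)
  have hupper : ‖∑ α ∈ MI n m, ∑ β ∈ MI n m,
      ∫ p, (starRingEnd ℂ) (mpd α φ p) * A α β p * (mpd β φ p - g β p)‖ ≤
      |Λ| * N * ε * ∑ α ∈ MI n m, t α := by
    rw [Finset.mul_sum]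
    refine norm_sum_le_of_le _ fun α hα => ?_
    have : |Λ| * N * ε * t α = ∑ _β ∈ MI n m, |Λ| * (t α * ε) := by
      rw [Finset.sum_const, nsmul_eq_mul, ← hN]
      ring
    rw [this]
    refine norm_sum_le_of_le _ fun β hβ => ?_
    refine (norm_integral_conj_mul_coef_mul_le (hφ.memLp_mpd α) (hAmeas α β) (hbd α hα β hβ)
      (hdiff β hβ)).trans ?_
    gcongr
    exact (hclose β hβ (hdiff β hβ)).le
  have hlower : lam * ∑ α ∈ MI n m, t α ^ 2 ≤ |Λ| * N * ε * ∑ α ∈ MI n m, t α := by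
    have h := hAG φ hφ.1 hφ.2.1
    simp only [← norm_toLp_sq (hφ.memLp_mpd _)] at h
    rw [hform] at h
    exact h.trans ((Complex.re_le_norm _).trans hupper)
  have hcs : (∑ α ∈ MI n m, t α) ^ 2 ≤ N * ∑ α ∈ MI n m, t α ^ 2 := sq_sum_le_card_mul_sum_sq
  have hS : 0 ≤ ∑ α ∈ MI n m, t α := Finset.sum_nonneg fun α _ => ht α
  have hsum : ∑ α ∈ MI n m, t α ≤ ε * (|Λ| * N ^ 2 / lam) := by
    set S := ∑ α ∈ MI n m, t α
    have hN0 : 0 ≤ N := Nat.cast_nonneg _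
    rcases hS.eq_or_lt with h0 | hpos
    · rw [← h0]
      positivity
    · have h1 : lam * S ^ 2 ≤ |Λ| * N ^ 2 * ε * S := by
        have h2 := mul_le_mul_of_nonneg_left hcs hlam.le
        have h3 := mul_le_mul_of_nonneg_left hlower hN0
        linarith
      have h4 : lam * S ≤ |Λ| * N ^ 2 * ε := by
        refine le_of_mul_le_mul_right ?_ hpos
        linarith
      rw [← mul_div_assoc, le_div_iff₀ hlam]
      linarith
  have hsplit : ‖(hgL2 α hα).toLp‖ ≤ t α + ‖(hdiff α hα).toLp‖ := by
    have : (hgL2 α hα).toLp = (hφ.memLp_mpd α).toLp - (hdiff α hα).toLp := by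
      rw [← MemLp.toLp_sub]
      congr 1
      ext p
      simp
    rw [this]
    exact norm_sub_le _ _
  have hle : t α ≤ ∑ α ∈ MI n m, t α := Finset.single_le_sum (fun α _ => ht α) hα
  linarith [hclose α hα (hdiff α hα)]

end NewtonPotential

/-- Suppose `u ∈ W²_m(ℝ^{n+1})` satisfies the variational problem for
the Newton potential `Π^L(1_− A ∇^m Δ^M H)` and `w ∈ W²_{m+2M}(ℝ^{n+1})` the one for
`Δ^M Π^{L̃}(1_− Ã ∇^{m+2M} H)`.  Then `∂^α u = ∂^α Δ^M w` a.e. for every `|α| = m`. -/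
theorem statement13 (n m M : ℕ) (hm : 1 ≤ m) (hM : 1 ≤ M)
    (lam Λ : ℝ) (hlam : 0 < lam)
    (A : Coef n) (hAmeas : CoefMeasurable A) (hAbd : CoefBounded m A Λ)
    (hAG : Garding m A lam)
    (H : (Fin n → ℝ) × ℝ → ℂ) (dH : (Fin (n + 1) → ℕ) → (Fin n → ℝ) × ℝ → ℂ)
    (hH : HasWDerivs Set.univ (m + 2 * M) H dH)
    (hHL2 : ∀ γ : Fin (n + 1) → ℕ, (∑ i, γ i) = m + 2 * M →
      (∫⁻ p, (‖dH γ p‖₊ : ℝ≥0∞) ^ 2) < ⊤)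
    (u : (Fin n → ℝ) × ℝ → ℂ) (du : (Fin (n + 1) → ℕ) → (Fin n → ℝ) × ℝ → ℂ)
    (hu : HasWDerivs Set.univ m u du)
    (huL2 : ∀ α ∈ MI n m, (∫⁻ p, (‖du α p‖₊ : ℝ≥0∞) ^ 2) < ⊤)
    (huVar : ∀ φ : (Fin n → ℝ) × ℝ → ℂ, ContDiff ℝ (⊤ : ℕ∞) φ → HasCompactSupport φ →
      ∑ α ∈ MI n m, ∑ β ∈ MI n m,
          ∫ p, (starRingEnd ℂ) (mpd α φ p) * A α β p * du β p =
        ∑ α ∈ MI n m, ∑ β ∈ MI n m,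
          ∫ p in lowerHalf n,
            (starRingEnd ℂ) (mpd α φ p) * A α β p * wLapPow M dH β p)
    (w : (Fin n → ℝ) × ℝ → ℂ) (dw : (Fin (n + 1) → ℕ) → (Fin n → ℝ) × ℝ → ℂ)
    (hw : HasWDerivs Set.univ (m + 2 * M) w dw)
    (hwL2 : ∀ δ : Fin (n + 1) → ℕ, (∑ i, δ i) = m + 2 * M →
      (∫⁻ p, (‖dw δ p‖₊ : ℝ≥0∞) ^ 2) < ⊤)
    (hwVar : ∀ Φ : (Fin n → ℝ) × ℝ → ℂ, ContDiff ℝ (⊤ : ℕ∞) Φ → HasCompactSupport Φ →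
      ∑ α ∈ MI n m, ∑ β ∈ MI n m,
          ∫ p, (starRingEnd ℂ) (mpd α (lapP^[M] Φ) p) * A α β p * wLapPow M dw β p =
        ∑ α ∈ MI n m, ∑ β ∈ MI n m,
          ∫ p in lowerHalf n,
            (starRingEnd ℂ) (mpd α (lapP^[M] Φ) p) * A α β p * wLapPow M dH β p) :
    ∀ α ∈ MI n m, ∀ᵐ p : (Fin n → ℝ) × ℝ, du α p = wLapPow M dw α p := by
  have hduL2 : ∀ β ∈ MI n m, MemLp (du β) 2 := fun β hβ =>
    memLp_two_of_lintegral_lt_top (hu.2 β (Finset.Nat.mem_antidiagonalTuple.1 hβ).le).1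
      (huL2 β hβ)
  have hdwL2 : ∀ β ∈ MI n m, MemLp (wLapPow M dw β) 2 := fun β hβ => memLp_wLapPow hw hwL2 hβ
  have hgL2 : ∀ β ∈ MI n m, MemLp (fun p => du β p - wLapPow M dw β p) 2 := fun β hβ =>
    (hduL2 β hβ).sub (hdwL2 β hβ)
  have hsymm : ∀ β ∈ MI n m, ∀ γ ∈ MI n m, ∀ θ, IsTest Set.univ θ →
      ∫ p, (du β p - wLapPow M dw β p) * mpd γ θ p =
        ∫ p, (du γ p - wLapPow M dw γ p) * mpd β θ p := by
    intro β hβ γ hγ θ hθ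
    have hsβ := Finset.Nat.mem_antidiagonalTuple.1 hβ
    have hsγ := Finset.Nat.mem_antidiagonalTuple.1 hγ
    have expand : ∀ β ∈ MI n m, ∀ γ, ∫ p, (du β p - wLapPow M dw β p) * mpd γ θ p =
        (∫ p, du β p * mpd γ θ p) - ∫ p, wLapPow M dw β p * mpd γ θ p := by
      intro β hβ γ
      simp only [sub_mul]
      exact integral_sub (MemLp.integrable_mul (hduL2 β hβ) (hθ.memLp_mpd γ))
        (MemLp.integrable_mul (hdwL2 β hβ) (hθ.memLp_mpd γ))
    rw [expand β hβ γ, expand γ hγ β, integral_wLapPow_mul_mpd_comm hw hwL2 hβ hγ hθ,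
      (hu.2 β hsβ.le).2.integral_mul_mpd_eq (hu.2 γ hsγ.le).2 (hsβ.trans hsγ.symm)
        (add_comm β γ) hθ]
  intro α hα
  have hbound : ∀ ε : ℝ, 0 < ε →
      ‖(hgL2 α hα).toLp‖ ≤ ε * (1 + |Λ| * (#(MI n m) : ℝ) ^ 2 / lam) := by
    intro ε hε
    obtain ⟨Φ, hΦ, hφ, hclose⟩ := exists_test_mpd_lapP_approx m M hgL2 hsymm hε
    refine hAG.norm_toLp_le hlam hAmeas hAbd hgL2 hφ ?_ hε hclose hα
    rw [← sub_eq_zero.2 ((huVar _ hφ.1 hφ.2.1).trans (hwVar Φ hΦ.1 hΦ.2.1).symm),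
      ← Finset.sum_sub_distrib]
    refine Finset.sum_congr rfl fun α hα => ?_
    rw [← Finset.sum_sub_distrib]
    refine Finset.sum_congr rfl fun β hβ => ?_
    simp only [mul_sub]
    exact integral_sub
      (integrable_conj_mul_coef_mul (hφ.memLp_mpd α) (hAmeas α β) (hAbd α hα β hβ) (hduL2 β hβ))
      (integrable_conj_mul_coef_mul (hφ.memLp_mpd α) (hAmeas α β) (hAbd α hα β hβ) (hdwL2 β hβ))
  have hzero : (hgL2 α hα).toLp = 0 := by
    rw [← norm_le_zero_iff]
    have hK : 0 < 1 + |Λ| * (#(MI n m) : ℝ) ^ 2 / lam := by positivity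
    refine le_of_forall_pos_le_add fun δ hδ => ?_
    have h := hbound _ (div_pos hδ hK)
    rwa [div_mul_cancel₀ _ hK.ne', ← zero_add δ] at h
  have hae := (hgL2 α hα).coeFn_toLp
  rw [hzero] at hae
  filter_upwards [hae, Lp.coeFn_zero ℂ 2 volume] with p h1 h2
  rw [h2] at h1
  exact sub_eq_zero.1 h1.symm

end
end
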